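/- arXiv:1501.06213 — 2 statements merged into one kernel-verified Lean document; each statement's English description precedes it below -/
import Mathlib

section
/- There exists a constant C_{α,β} > 0, depending only on α and β, such that for every n ∈ ℕ, every k ∈ ℕ, all λ₁, …, λ_k ≥ 0, and every polynomial P ∈ P_n, ‖P'‖_{W^{k,2}([−1,1]; w,λ₁w,…,λ_kw)} ≤ C_{α,β} · n² · ‖P‖_{W^{k,2}([−1,1]; w,λ₁w,…,λ_kw)}, where w(x) = (1−x)^α (1+x)^β on [−1,1] and α, β > −1. -/
open MeasureTheory Polynomial

/-- The weighted L² norm of a polynomial `P` over a set `A ⊆ ℝ` with weight `w`: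
`‖P‖_{L²(A,w)} = (∫_A |P(x)|² w(x) dx)^{1/2}`. -/
noncomputable def L2w (A : Set ℝ) (w : ℝ → ℝ) (P : Polynomial ℝ) : ℝ :=
  Real.sqrt (∫ x in A, (P.eval x) ^ 2 * w x)

/-- The weighted Sobolev norm
`‖P‖_{W^{k,2}(A; w, λ₁w, …, λ_k w)} = (‖P‖²_{L²(A,w)} + ∑_{j=1}^k λ_j ‖P^{(j)}‖²_{L²(A,w)})^{1/2}`. -/
noncomputable def sobNorm (A : Set ℝ) (w : ℝ → ℝ) (k : ℕ) (lam : ℕ → ℝ)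
    (P : Polynomial ℝ) : ℝ :=
  Real.sqrt ((L2w A w P) ^ 2 +
    ∑ j ∈ Finset.Icc 1 k, lam j * (L2w A w (derivative^[j] P)) ^ 2)

/-- The Jacobi weight `(1 - x)^α (1 + x)^β`. -/
noncomputable def jacobiWeight (α β x : ℝ) : ℝ := (1 - x) ^ α * (1 + x) ^ β

theorem jacobiWeight_nonneg (α β : ℝ) {x : ℝ} (hx : x ∈ Set.Icc (-1 : ℝ) 1) :
    0 ≤ jacobiWeight α β x :=
  mul_nonneg (Real.rpow_nonneg (by linarith [hx.2]) _) (Real.rpow_nonneg (by linarith [hx.1]) _)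

theorem jacobiWeight_add_one {α β : ℝ} (hα : -1 < α) (hβ : -1 < β) {x : ℝ}
    (hx : x ∈ Set.Icc (-1 : ℝ) 1) :
    jacobiWeight (α + 1) (β + 1) x = (1 - x ^ 2) * jacobiWeight α β x := by
  unfold jacobiWeight
  rw [Real.rpow_add_one' (by linarith [hx.2]) (by linarith),
    Real.rpow_add_one' (by linarith [hx.1]) (by linarith)]
  ring

theorem integrableOn_jacobiWeight {α β : ℝ} (hα : -1 < α) (hβ : -1 < β) :
    IntegrableOn (jacobiWeight α β) (Set.Icc (-1) 1) := by
  have hunion : Set.Icc (-1 : ℝ) 1 = Set.Icc (-1) 0 ∪ Set.Icc 0 1 :=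
    (Set.Icc_union_Icc_eq_Icc (by norm_num) (by norm_num)).symm
  rw [hunion]
  refine IntegrableOn.union ?_ ?_
  · have h : IntervalIntegrable (fun x : ℝ => (1 + x) ^ β) volume (-1) 0 := by
      have := (intervalIntegral.intervalIntegrable_rpow' (a := 0) (b := 1) hβ).comp_add_left 1
      norm_num at this
      exact this
    rw [intervalIntegrable_iff_integrableOn_Icc_of_le (by norm_num)] at h
    refine h.continuousOn_mul (fun x hx => ?_) isCompact_Icc
    exact ((continuousAt_const.sub continuousAt_id).rpow_const
      (Or.inl (sub_pos.2 (hx.2.trans_lt one_pos)).ne')).continuousWithinAt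
  · have h : IntervalIntegrable (fun x : ℝ => (1 - x) ^ α) volume 0 1 := by
      have := (intervalIntegral.intervalIntegrable_rpow' (a := 0) (b := 1) hα).comp_sub_left 1
      norm_num at this
      exact this.symm
    rw [intervalIntegrable_iff_integrableOn_Icc_of_le (by norm_num)] at h
    refine h.mul_continuousOn (fun x hx => ?_) isCompact_Icc
    exact ((continuousAt_const.add continuousAt_id).rpow_const
      (Or.inl (add_pos_of_pos_of_nonneg one_pos hx.1).ne')).continuousWithinAt

theorem integrableOn_eval_mul_jacobiWeight {α β : ℝ} (hα : -1 < α) (hβ : -1 < β) (P : ℝ[X]) :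
    IntegrableOn (fun x => P.eval x * jacobiWeight α β x) (Set.Icc (-1) 1) :=
  (integrableOn_jacobiWeight hα hβ).continuousOn_mul P.continuousOn isCompact_Icc

/-- Integration of polynomials against the Jacobi weight. -/
noncomputable def jacobiIntegral (α β : ℝ) (hα : -1 < α) (hβ : -1 < β) : ℝ[X] →ₗ[ℝ] ℝ where
  toFun P := ∫ x in Set.Icc (-1) 1, P.eval x * jacobiWeight α β x
  map_add' P Q := by
    rw [← integral_add (integrableOn_eval_mul_jacobiWeight hα hβ P)
      (integrableOn_eval_mul_jacobiWeight hα hβ Q)]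
    simp only [eval_add, add_mul]
  map_smul' c P := by
    simp only [eval_smul, smul_eq_mul, mul_assoc, RingHom.id_apply]
    exact integral_const_mul _ _

section

variable {α β : ℝ} (hα : -1 < α) (hβ : -1 < β)

theorem jacobiIntegral_apply (P : ℝ[X]) : jacobiIntegral α β hα hβ P =
    ∫ x in Set.Icc (-1) 1, P.eval x * jacobiWeight α β x := rfl

theorem jacobiIntegral_nonneg {P : ℝ[X]} (hP : ∀ x ∈ Set.Icc (-1 : ℝ) 1, 0 ≤ P.eval x) :
    0 ≤ jacobiIntegral α β hα hβ P :=
  setIntegral_nonneg measurableSet_Icc fun x hx =>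
    mul_nonneg (hP x hx) (jacobiWeight_nonneg α β hx)

theorem jacobiIntegral_mono {P Q : ℝ[X]} (h : ∀ x ∈ Set.Icc (-1 : ℝ) 1, P.eval x ≤ Q.eval x) :
    jacobiIntegral α β hα hβ P ≤ jacobiIntegral α β hα hβ Q := by
  rw [← sub_nonneg, ← map_sub]
  exact jacobiIntegral_nonneg hα hβ fun x hx => by simpa using h x hx

theorem jacobiIntegral_C_mul (c : ℝ) (P : ℝ[X]) :
    jacobiIntegral α β hα hβ (C c * P) = c * jacobiIntegral α β hα hβ P := by
  rw [← smul_eq_C_mul, map_smul, smul_eq_mul]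

theorem jacobiIntegral_add_one (hα' : -1 < α + 1) (hβ' : -1 < β + 1) (P : ℝ[X]) :
    jacobiIntegral (α + 1) (β + 1) hα' hβ' P = jacobiIntegral α β hα hβ ((1 - X ^ 2) * P) := by
  rw [jacobiIntegral_apply, jacobiIntegral_apply]
  refine setIntegral_congr_fun measurableSet_Icc fun x hx => ?_
  simp only [jacobiWeight_add_one hα hβ hx, eval_mul, eval_sub, eval_one, eval_pow, eval_X]
  ring

theorem jacobiIntegral_mul_sq_le (P Q : ℝ[X]) :
    jacobiIntegral α β hα hβ (P * Q) ^ 2 ≤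
      jacobiIntegral α β hα hβ (P ^ 2) * jacobiIntegral α β hα hβ (Q ^ 2) := by
  have key : ∀ t : ℝ, 0 ≤ jacobiIntegral α β hα hβ (P ^ 2) * (t * t) +
      2 * jacobiIntegral α β hα hβ (P * Q) * t + jacobiIntegral α β hα hβ (Q ^ 2) := by
    intro t
    have h : 0 ≤ jacobiIntegral α β hα hβ ((C t * P + Q) ^ 2) :=
      jacobiIntegral_nonneg hα hβ fun x _ => by simpa using sq_nonneg _
    have e : (C t * P + Q) ^ 2 = C (t * t) * P ^ 2 + C (2 * t) * (P * Q) + Q ^ 2 := by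
      simp only [map_mul, map_ofNat]; ring
    rw [e, map_add, map_add, jacobiIntegral_C_mul, jacobiIntegral_C_mul] at h
    linarith
  have := discrim_le_zero key
  unfold discrim at this
  linarith

theorem hasDerivAt_jacobiWeight_add_one (α β : ℝ) {x : ℝ}
    (hx : x ∈ Set.Ioo (-1 : ℝ) 1) :
    HasDerivAt (jacobiWeight (α + 1) (β + 1))
      ((β - α - (α + β + 2) * x) * jacobiWeight α β x) x := by
  have h1 : 0 < 1 - x := by linarith [hx.2]
  have h2 : 0 < 1 + x := by linarith [hx.1]
  have d1 := ((hasDerivAt_id x).const_sub 1).rpow_const (p := α + 1) (Or.inl h1.ne')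
  have d2 := ((hasDerivAt_id x).const_add 1).rpow_const (p := β + 1) (Or.inl h2.ne')
  refine (d1.mul d2).congr_deriv ?_
  simp only [id, jacobiWeight, add_sub_cancel_right, Real.rpow_add_one h1.ne',
    Real.rpow_add_one h2.ne']
  ring

theorem jacobiIntegral_integration_by_parts (R : ℝ[X]) :
    jacobiIntegral α β hα hβ
      ((1 - X ^ 2) * derivative R + (C (β - α) - C (α + β + 2) * X) * R) = 0 := by
  set S := (1 - X ^ 2) * derivative R + (C (β - α) - C (α + β + 2) * X) * R with hS
  have hcont : ContinuousOn (fun x => R.eval x * jacobiWeight (α + 1) (β + 1) x)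
      (Set.Icc (-1) 1) := by
    refine R.continuousOn.mul (Continuous.continuousOn ?_)
    exact ((continuous_const.sub continuous_id).rpow_const fun _ => Or.inr (by linarith)).mul
      ((continuous_const.add continuous_id).rpow_const fun _ => Or.inr (by linarith))
  have hderiv : ∀ x ∈ Set.Ioo (-1 : ℝ) 1,
      HasDerivAt (fun x => R.eval x * jacobiWeight (α + 1) (β + 1) x)
        (S.eval x * jacobiWeight α β x) x := by
    intro x hx
    refine ((R.hasDerivAt x).mul (hasDerivAt_jacobiWeight_add_one α β hx)).congr_deriv ?_
    rw [jacobiWeight_add_one hα hβ (Set.Ioo_subset_Icc_self hx), hS]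
    simp only [eval_add, eval_mul, eval_sub, eval_one, eval_pow, eval_X, eval_C]
    ring
  have hinteg : IntervalIntegrable (fun x => S.eval x * jacobiWeight α β x) volume (-1) 1 :=
    (intervalIntegrable_iff_integrableOn_Icc_of_le (by norm_num)).2
      (integrableOn_eval_mul_jacobiWeight hα hβ S)
  have h := intervalIntegral.integral_eq_sub_of_hasDerivAt_of_le (by norm_num) hcont hderiv hinteg
  rw [intervalIntegral.integral_of_le (by norm_num), ← integral_Icc_eq_integral_Ioc] at h
  rw [jacobiIntegral_apply, h]
  have h1 : jacobiWeight (α + 1) (β + 1) 1 = 0 := by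
    simp [jacobiWeight, Real.zero_rpow (show α + 1 ≠ 0 by linarith)]
  have h2 : jacobiWeight (α + 1) (β + 1) (-1) = 0 := by
    simp [jacobiWeight, Real.zero_rpow (show β + 1 ≠ 0 by linarith)]
  rw [h1, h2]
  ring

/-- The Jacobi differential operator
`L P = -((1 - x²) P'' + (β - α - (α + β + 2) x) P')`. -/
noncomputable def jacobiOperator (α β : ℝ) (P : ℝ[X]) : ℝ[X] :=
  -((1 - X ^ 2) * derivative (derivative P) +
    (C (β - α) - C (α + β + 2) * X) * derivative P)

theorem jacobiIntegral_jacobiOperator_mul (P Q : ℝ[X]) :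
    jacobiIntegral α β hα hβ (jacobiOperator α β P * Q) =
      jacobiIntegral α β hα hβ ((1 - X ^ 2) * (derivative P * derivative Q)) := by
  have h := jacobiIntegral_integration_by_parts hα hβ (derivative P * Q)
  rw [← sub_eq_zero, ← map_sub, ← neg_eq_zero, ← map_neg, ← h]
  congr 1
  rw [jacobiOperator, derivative_mul]
  ring

theorem derivative_jacobiOperator (α β : ℝ) (P : ℝ[X]) :
    derivative (jacobiOperator α β P) =
      jacobiOperator (α + 1) (β + 1) (derivative P) + C (α + β + 2) * derivative P := by
  simp only [jacobiOperator, derivative_neg, derivative_add, derivative_mul, derivative_sub,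
    derivative_one, derivative_X_pow, derivative_C, derivative_X, C_add, C_sub, C_1, C_ofNat,
    derivative_ofNat, Nat.cast_ofNat]
  ring

end

/-- The Bernstein inequality for Jacobi weights in `L²`, with the sharp constant. -/
theorem jacobiIntegral_bernstein (n : ℕ) {α β : ℝ} (hα : -1 < α) (hβ : -1 < β) {P : ℝ[X]}
    (hP : P.natDegree ≤ n) :
    jacobiIntegral α β hα hβ ((1 - X ^ 2) * derivative P ^ 2) ≤
      n * (n + α + β + 1) * jacobiIntegral α β hα hβ (P ^ 2) := by
  induction n generalizing α β P with
  | zero =>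
    rw [derivative_of_natDegree_zero (Nat.le_zero.1 hP)]
    simp
  | succ n ih =>
    have hα' : -1 < α + 1 := by linarith
    have hβ' : -1 < β + 1 := by linarith
    have hP' : (derivative P).natDegree ≤ n := (natDegree_derivative_le P).trans (by omega)
    set D := jacobiIntegral α β hα hβ ((1 - X ^ 2) * derivative P ^ 2) with hD
    set N := jacobiIntegral α β hα hβ (P ^ 2) with hN
    set E := jacobiIntegral α β hα hβ (jacobiOperator α β P ^ 2) with hE
    have hDL : jacobiIntegral α β hα hβ (jacobiOperator α β P * P) = D := by
      rw [jacobiIntegral_jacobiOperator_mul, hD, sq (derivative P)]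
    have hD0 : 0 ≤ D := jacobiIntegral_nonneg hα hβ fun x hx => by
      simp only [eval_mul, eval_sub, eval_one, eval_pow, eval_X]
      exact mul_nonneg (by nlinarith [hx.1, hx.2]) (sq_nonneg _)
    have hN0 : 0 ≤ N := jacobiIntegral_nonneg hα hβ fun x _ => by
      simpa using sq_nonneg _
    have hED : E ≤ ((n + 1 : ℕ) * ((n + 1 : ℕ) + α + β + 1)) * D := by
      have h := ih hα' hβ' hP'
      have hshift : D = jacobiIntegral (α + 1) (β + 1) hα' hβ' (derivative P ^ 2) :=
        (jacobiIntegral_add_one hα hβ hα' hβ' _).symm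
      have e : E = jacobiIntegral (α + 1) (β + 1) hα' hβ'
          ((1 - X ^ 2) * derivative (derivative P) ^ 2) + (α + β + 2) * D := by
        have hpoly : derivative P * derivative (jacobiOperator α β P) =
            jacobiOperator (α + 1) (β + 1) (derivative P) * derivative P +
              C (α + β + 2) * derivative P ^ 2 := by
          rw [derivative_jacobiOperator]
          ring
        rw [hE, sq (jacobiOperator α β P), jacobiIntegral_jacobiOperator_mul,
          ← jacobiIntegral_add_one hα hβ hα' hβ', hpoly, map_add,
          jacobiIntegral_jacobiOperator_mul, jacobiIntegral_C_mul, ← hshift,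
          sq (derivative (derivative P))]
      rw [← hshift] at h
      rw [e]
      push_cast
      linarith
    have hCS : D ^ 2 ≤ E * N := by
      rw [← hDL]
      exact jacobiIntegral_mul_sq_le hα hβ _ _
    rcases hD0.eq_or_lt with h0 | hpos
    · rw [← h0]
      refine mul_nonneg (mul_nonneg (by positivity) ?_) hN0
      push_cast
      linarith [(Nat.cast_nonneg n : (0 : ℝ) ≤ n)]
    · refine le_of_mul_le_mul_right ?_ hpos
      nlinarith [mul_le_mul_of_nonneg_right hED hN0]

theorem jacobiIntegral_bernstein_of_one_le {n : ℕ} (hn : 1 ≤ n) {α β : ℝ} (hα : -1 < α)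
    (hβ : -1 < β) {P : ℝ[X]} (hP : P.natDegree ≤ n) :
    jacobiIntegral α β hα hβ ((1 - X ^ 2) * derivative P ^ 2) ≤
      n ^ 2 * (α + β + 3) * jacobiIntegral α β hα hβ (P ^ 2) := by
  have hN0 : 0 ≤ jacobiIntegral α β hα hβ (P ^ 2) :=
    jacobiIntegral_nonneg hα hβ fun x _ => by simpa using sq_nonneg _
  refine (jacobiIntegral_bernstein n hα hβ hP).trans (mul_le_mul_of_nonneg_right ?_ hN0)
  have hn' : (1 : ℝ) ≤ n := by exact_mod_cast hn
  have h : (0 : ℝ) ≤ (n - 1) * (α + β + 2) := mul_nonneg (by linarith) (by linarith)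
  have := mul_nonneg (zero_le_one.trans hn') (add_nonneg h zero_le_one)
  linarith

theorem exists_sq_le_sub_sq_add {a : ℝ} (ha : a ^ 2 < 1) :
    ∃ t : ℝ, 0 < t ∧ ∀ x : ℝ, t ^ 2 ≤ (x - a) ^ 2 + t * (1 - x ^ 2) := by
  refine ⟨(1 - a ^ 2) / 2, by linarith, fun x => ?_⟩
  nlinarith [sq_nonneg ((1 + a ^ 2) * x - 2 * a), sq_nonneg (1 - a ^ 2), sq_nonneg a,
    mul_nonneg (sq_nonneg a) (sq_nonneg (1 - a ^ 2)),
    mul_nonneg (sub_nonneg.2 ha.le) (sq_nonneg (1 - a ^ 2))]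

/-- A Schur-type inequality for Jacobi weights in `L²`. -/
theorem exists_jacobiIntegral_schur {α β : ℝ} (hα : -1 < α) (hβ : -1 < β) :
    ∃ K : ℝ, 0 < K ∧ ∀ n : ℕ, 1 ≤ n → ∀ Q : ℝ[X], Q.natDegree ≤ n →
      jacobiIntegral α β hα hβ (Q ^ 2) ≤
        K * n ^ 2 * jacobiIntegral α β hα hβ ((1 - X ^ 2) * Q ^ 2) := by
  obtain ⟨s, hs⟩ : ∃ s, s = α + β + 2 := ⟨_, rfl⟩
  have hs0 : 0 < s := by linarith
  obtain ⟨a, ha⟩ : ∃ a, a = (β - α) / s := ⟨_, rfl⟩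
  have has : s * a = β - α := by rw [ha]; field_simp
  have ha1 : a < 1 := by rw [ha, div_lt_one hs0]; linarith
  have ha2 : -1 < a := by rw [ha, lt_div_iff₀ hs0]; linarith
  obtain ⟨t, ht, hquad⟩ := exists_sq_le_sub_sq_add (a := a) (by nlinarith)
  refine ⟨2 / t ^ 2 * (1 / s + t + 8 * (1 + s) / (t ^ 2 * s ^ 2)), by positivity, ?_⟩
  intro n hn Q hQ
  have hn' : (1 : ℝ) ≤ n := by exact_mod_cast hn
  set A := jacobiIntegral α β hα hβ ((1 - X ^ 2) * Q ^ 2) with hA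
  set B := jacobiIntegral α β hα hβ (Q ^ 2) with hB
  set D := jacobiIntegral α β hα hβ ((1 - X ^ 2) * derivative Q ^ 2) with hD
  set M := jacobiIntegral α β hα hβ ((X - C a) ^ 2 * Q ^ 2) with hM
  set Y := jacobiIntegral α β hα hβ ((1 - X ^ 2) * (2 * Q * derivative Q * (X - C a))) with hY
  have hA0 : 0 ≤ A := jacobiIntegral_nonneg hα hβ fun x hx => by
    simp only [eval_mul, eval_sub, eval_one, eval_pow, eval_X]
    exact mul_nonneg (by nlinarith [hx.1, hx.2]) (sq_nonneg _)
  have hB0 : 0 ≤ B := jacobiIntegral_nonneg hα hβ fun x _ => by simpa using sq_nonneg _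
  have hparts : s * M = A + Y := by
    have h := jacobiIntegral_integration_by_parts hα hβ (Q ^ 2 * (X - C a))
    rw [← has, ← hs] at h
    rw [hA, hY, hM, ← jacobiIntegral_C_mul, ← sub_eq_zero, ← map_add, ← map_sub,
      ← neg_eq_zero, ← map_neg, ← h]
    congr 1
    simp only [derivative_mul, derivative_sub, derivative_X, derivative_C, derivative_sq, map_mul,
      map_ofNat]
    ring
  have hBM : t ^ 2 * B ≤ M + t * A := by
    rw [hA, hB, hM, ← jacobiIntegral_C_mul, ← jacobiIntegral_C_mul, ← map_add]
    refine jacobiIntegral_mono hα hβ fun x _ => ?_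
    simp only [eval_mul, eval_add, eval_sub, eval_one, eval_pow, eval_X, eval_C]
    nlinarith [mul_le_mul_of_nonneg_right (hquad x) (sq_nonneg (Q.eval x))]
  have hbern : D ≤ n ^ 2 * (1 + s) * B := by
    have h := jacobiIntegral_bernstein_of_one_le hn hα hβ hQ
    rwa [show α + β + 3 = 1 + s by rw [hs]; ring] at h
  obtain ⟨δ, hδ⟩ : ∃ δ, δ = t ^ 2 * s / (8 * (n ^ 2 * (1 + s))) := ⟨_, rfl⟩
  have hδ0 : 0 < δ := by rw [hδ]; positivity
  have hYle : Y ≤ δ⁻¹ * A + 4 * δ * D := by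
    rw [hA, hY, hD, ← jacobiIntegral_C_mul, ← jacobiIntegral_C_mul, ← map_add]
    refine jacobiIntegral_mono hα hβ fun x hx => ?_
    simp only [eval_mul, eval_add, eval_sub, eval_one, eval_pow, eval_X, eval_C, eval_ofNat]
    have hx2 : 0 ≤ 1 - x ^ 2 := by nlinarith [hx.1, hx.2]
    have hxa : (x - a) ^ 2 ≤ 4 := by nlinarith [hx.1, hx.2]
    generalize Q.eval x = q
    generalize (derivative Q).eval x = r
    have h1 : 2 * q * r * (x - a) ≤ δ⁻¹ * q ^ 2 + 4 * δ * r ^ 2 := by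
      have h2 : 0 ≤ δ⁻¹ * (q - δ * (r * (x - a))) ^ 2 := by positivity
      have h3 : δ⁻¹ * (q - δ * (r * (x - a))) ^ 2 =
          δ⁻¹ * q ^ 2 - 2 * q * r * (x - a) + δ * r ^ 2 * (x - a) ^ 2 := by
        field_simp
        ring
      have h4 := mul_le_mul_of_nonneg_left hxa (show 0 ≤ δ * r ^ 2 by positivity)
      linarith
    nlinarith [mul_le_mul_of_nonneg_left h1 hx2]
  have hδD : 4 * δ * D ≤ s * (t ^ 2 / 2 * B) := by
    refine (mul_le_mul_of_nonneg_left hbern (by positivity)).trans_eq ?_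
    rw [hδ]
    field_simp
    ring
  have hδinv : δ⁻¹ = s * (8 * (1 + s) / (t ^ 2 * s ^ 2) * n ^ 2) := by
    rw [hδ]
    field_simp
  have hmain : t ^ 2 / 2 * B ≤ (1 / s + t + 8 * (1 + s) / (t ^ 2 * s ^ 2) * n ^ 2) * A := by
    refine le_of_mul_le_mul_left ?_ hs0
    have h1 := mul_le_mul_of_nonneg_left hBM hs0.le
    have h2 : s * (1 / s) = 1 := by field_simp
    rw [hδinv] at hYle
    linear_combination h1 + hparts + hYle + hδD - A * h2
  have hn2 : (1 : ℝ) ≤ n ^ 2 := one_le_pow₀ hn'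
  have hK : (1 / s + t + 8 * (1 + s) / (t ^ 2 * s ^ 2) * n ^ 2) * A ≤
      (1 / s + t + 8 * (1 + s) / (t ^ 2 * s ^ 2)) * n ^ 2 * A := by
    refine mul_le_mul_of_nonneg_right ?_ hA0
    have := mul_le_mul_of_nonneg_left hn2 (show 0 ≤ 1 / s + t by positivity)
    linarith
  calc B = 2 / t ^ 2 * (t ^ 2 / 2 * B) := by field_simp
    _ ≤ 2 / t ^ 2 * ((1 / s + t + 8 * (1 + s) / (t ^ 2 * s ^ 2)) * n ^ 2 * A) :=
      mul_le_mul_of_nonneg_left (hmain.trans hK) (by positivity)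
    _ = _ := by ring

/-- The Markov inequality for Jacobi weights in `L²`. -/
theorem exists_jacobiIntegral_markov {α β : ℝ} (hα : -1 < α) (hβ : -1 < β) :
    ∃ C : ℝ, 0 < C ∧ ∀ (n : ℕ) (P : ℝ[X]), P.natDegree ≤ n →
      jacobiIntegral α β hα hβ (derivative P ^ 2) ≤
        (C * n ^ 2) ^ 2 * jacobiIntegral α β hα hβ (P ^ 2) := by
  obtain ⟨K, hK, hschur⟩ := exists_jacobiIntegral_schur hα hβ
  have hs : 0 < α + β + 3 := by linarith
  refine ⟨√(K * (α + β + 3)), by positivity, fun n P hP => ?_⟩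
  rcases Nat.eq_zero_or_pos n with rfl | hn
  · simp [derivative_of_natDegree_zero (Nat.le_zero.1 hP)]
  calc _ ≤ _ := hschur n hn _ ((natDegree_derivative_le P).trans (by omega))
    _ ≤ _ := mul_le_mul_of_nonneg_left
      (jacobiIntegral_bernstein_of_one_le hn hα hβ hP) (by positivity)
    _ = _ := by
      rw [mul_pow, Real.sq_sqrt (by positivity)]
      ring

theorem L2w_jacobiWeight_sq {α β : ℝ} (hα : -1 < α) (hβ : -1 < β) (P : ℝ[X]) :
    L2w (Set.Icc (-1) 1) (fun x => (1 - x) ^ α * (1 + x) ^ β) P ^ 2 =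
      jacobiIntegral α β hα hβ (P ^ 2) := by
  have h : (∫ x in Set.Icc (-1 : ℝ) 1, P.eval x ^ 2 * ((1 - x) ^ α * (1 + x) ^ β)) =
      jacobiIntegral α β hα hβ (P ^ 2) := by
    simp only [jacobiIntegral_apply, eval_pow, jacobiWeight]
  rw [L2w, h, Real.sq_sqrt]
  exact jacobiIntegral_nonneg hα hβ fun x _ => by simpa using sq_nonneg _

/-- Markov-type inequality in the Jacobi–Sobolev case:
`w(x) = (1-x)^α (1+x)^β` on `[-1,1]`, `α, β > -1`. -/
theorem jacobi_sobolev_markov (α β : ℝ) (hα : -1 < α) (hβ : -1 < β) :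
    ∃ C : ℝ, 0 < C ∧ ∀ (n k : ℕ) (lam : ℕ → ℝ), (∀ j ∈ Finset.Icc 1 k, 0 ≤ lam j) →
      ∀ P : Polynomial ℝ, P.natDegree ≤ n →
        sobNorm (Set.Icc (-1) 1) (fun x => (1 - x) ^ α * (1 + x) ^ β) k lam (derivative P) ≤
          C * n ^ 2 *
            sobNorm (Set.Icc (-1) 1) (fun x => (1 - x) ^ α * (1 + x) ^ β) k lam P := by
  obtain ⟨C, hC, hmarkov⟩ := exists_jacobiIntegral_markov hα hβ
  refine ⟨C, hC, fun n k lam hlam P hP => ?_⟩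
  have hc : 0 ≤ C * (n : ℝ) ^ 2 := by positivity
  rw [sobNorm, sobNorm, ← Real.sqrt_sq hc, ← Real.sqrt_mul (sq_nonneg _)]
  refine Real.sqrt_le_sqrt ?_
  rw [mul_add, Finset.mul_sum]
  simp only [L2w_jacobiWeight_sq hα hβ]
  refine add_le_add (hmarkov n P hP) (Finset.sum_le_sum fun j hj => ?_)
  rw [← Function.iterate_succ_apply, Function.iterate_succ_apply', mul_left_comm]
  exact mul_le_mul_of_nonneg_left (hmarkov n _
    ((natDegree_iterate_derivative P j).trans ((Nat.sub_le _ _).trans hP))) (hlam j hj)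
end

section
/- Let α, β > −1 with max(α,β) ≥ −1/2. Then there exists a constant k₁ > 0, depending only on α and β, such that for every n ∈ ℕ with n ≥ 1 and every polynomial P ∈ P_n, ∫_{−1}^{1} |P(x)|² dx ≤ k₁ · n^{v(α,β)} · ∫_{−1}^{1} |P(x)|² (1−x)^α (1+x)^β dx, where v(α,β) := α + β + |α−β| + 2. -/
open MeasureTheory Polynomial

/-- Markov's inequality at the right endpoint of `[-1, 1]`. -/
theorem eval_one_derivative_le_of_abs_le {n : ℕ} {P : ℝ[X]} {M : ℝ} (hM : 0 < M)
    (hdeg : P.natDegree ≤ n) (hP : ∀ x ∈ Set.Icc (-1 : ℝ) 1, |P.eval x| ≤ M) :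
    (derivative P).eval 1 ≤ (n : ℝ) ^ 2 * M := by
  have hT : (derivative (Chebyshev.T ℝ n)).eval 1 = (n : ℝ) ^ 2 := by
    rw [Chebyshev.T_derivative_eq_U]
    simp [sq]
  have h := Chebyshev.eval_iterate_derivative_le_of_forall_abs_le_one (n := n)
    (P := C M⁻¹ * P) (k := 1) (x := 1) le_rfl
    (natDegree_le_iff_degree_le.mp ((natDegree_C_mul_le _ _).trans hdeg)) (fun x hx => by
      rw [eval_mul, eval_C, abs_mul, abs_of_pos (inv_pos.mpr hM), inv_mul_le_iff₀ hM, mul_one]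
      exact hP x hx)
  simp only [Function.iterate_one, derivative_C_mul, eval_mul, eval_C, hT] at h
  rwa [inv_mul_le_iff₀ hM, mul_comm] at h

theorem exists_derivative_eq (P : ℝ[X]) :
    ∃ Q : ℝ[X], derivative Q = P ∧ Q.natDegree ≤ P.natDegree + 1 := by
  refine ⟨∑ i ∈ Finset.range (P.natDegree + 1), C (P.coeff i / (i + 1)) * X ^ (i + 1), ?_, ?_⟩
  · conv_rhs => rw [P.as_sum_range_C_mul_X_pow]
    rw [derivative_sum]
    refine Finset.sum_congr rfl fun i _ => ?_
    rw [derivative_C_mul_X_pow]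
    congr 2
    push_cast
    field_simp
  · refine natDegree_sum_le_of_forall_le _ _ fun i hi => (natDegree_C_mul_X_pow_le _ _).trans ?_
    exact Finset.mem_range.mp hi

/-- A Nikolskii-type inequality at the right endpoint of an interval. -/
theorem eval_sq_mul_le_integral {n : ℕ} {P : ℝ[X]} (hdeg : P.natDegree ≤ n) {a b : ℝ}
    (hab : a < b) :
    P.eval b ^ 2 * (b - a) ≤ 2 * (2 * n + 1) ^ 2 * ∫ x in a..b, P.eval x ^ 2 := by
  have hcont : Continuous fun x => P.eval x ^ 2 := by fun_prop
  by_cases hb : P.eval b = 0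
  · rw [hb]
    have := intervalIntegral.integral_nonneg (μ := volume) hab.le
      (f := fun x => P.eval x ^ 2) (fun x _ => sq_nonneg _)
    simp only [ne_eq, OfNat.ofNat_ne_zero, not_false_eq_true, zero_pow, zero_mul]
    positivity
  have hpos : 0 < ∫ x in a..b, P.eval x ^ 2 :=
    intervalIntegral.integral_pos hab hcont.continuousOn (fun x _ => sq_nonneg _)
      ⟨b, ⟨hab.le, le_rfl⟩, by positivity⟩
  obtain ⟨Q, hQ, hQdeg⟩ := exists_derivative_eq (P ^ 2)
  have hFTC (y : ℝ) : ∫ x in a..y, P.eval x ^ 2 = Q.eval y - Q.eval a := by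
    refine intervalIntegral.integral_eq_sub_of_hasDerivAt (f := fun x => Q.eval x) (fun x _ => ?_)
      (hcont.intervalIntegrable _ _)
    simpa [hQ] using Q.hasDerivAt x
  have hQn : Q.natDegree ≤ 2 * n + 1 := by
    have := natDegree_pow_le (p := P) (n := 2)
    omega
  set L : ℝ[X] := C ((b - a) / 2) * X + C ((a + b) / 2) with hL
  have hLdeg : L.natDegree ≤ 1 := natDegree_linear_le
  have h := eval_one_derivative_le_of_abs_le (n := 2 * n + 1) (P := Q.comp L - C (Q.eval a)) hpos
    (by
      rw [natDegree_sub_C]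
      refine natDegree_comp_le.trans ?_
      nlinarith)
    (fun x hx => by
      obtain ⟨h1, h2⟩ := hx
      have hy : L.eval x = (b - a) / 2 * x + (a + b) / 2 := by simp [hL]
      have hay : a ≤ L.eval x := by rw [hy]; nlinarith
      have hyb : L.eval x ≤ b := by rw [hy]; nlinarith
      rw [eval_sub, eval_comp, eval_C, ← hFTC, abs_of_nonneg
        (intervalIntegral.integral_nonneg hay fun x _ => sq_nonneg _)]
      exact intervalIntegral.integral_mono_interval le_rfl hay hyb
        (Filter.Eventually.of_forall fun x => sq_nonneg _) (hcont.intervalIntegrable _ _))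
  have hL1 : L.eval 1 = b := by simp [hL]; ring
  have hL' : derivative L = C ((b - a) / 2) := by simp [hL]
  rw [derivative_sub, derivative_C, sub_zero, derivative_comp, hL', hQ, eval_mul, eval_C,
    eval_comp, hL1, eval_pow] at h
  push_cast at h
  linarith

/-- A Nikolskii-type inequality on `[-1, 1]`. -/
theorem eval_sq_le_integral {n : ℕ} (hn : 1 ≤ n) {P : ℝ[X]} (hdeg : P.natDegree ≤ n) {x : ℝ}
    (hx : x ∈ Set.Icc (-1 : ℝ) 1) :
    P.eval x ^ 2 ≤ 18 * n ^ 2 * ∫ y in (-1 : ℝ)..1, P.eval y ^ 2 := by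
  wlog h0 : 0 ≤ x generalizing P x
  · have h := this (P := P.comp (-X)) (x := -x) (by simpa [natDegree_comp] using hdeg)
      ⟨by linarith [hx.2], by linarith [hx.1]⟩ (by linarith)
    have hneg := intervalIntegral.integral_comp_neg (a := -1) (b := 1) fun y => P.eval y ^ 2
    simp only [eval_comp, eval_neg, eval_X, neg_neg] at h hneg
    rwa [hneg] at h
  have hn' : (1 : ℝ) ≤ n := by exact_mod_cast hn
  have hmono : ∫ y in (-1 : ℝ)..x, P.eval y ^ 2 ≤ ∫ y in (-1 : ℝ)..1, P.eval y ^ 2 :=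
    intervalIntegral.integral_mono_interval le_rfl hx.1 hx.2
      (Filter.Eventually.of_forall fun x => sq_nonneg _)
      ((by fun_prop : Continuous fun x => P.eval x ^ 2).intervalIntegrable _ _)
  have hnn : 0 ≤ ∫ y in (-1 : ℝ)..x, P.eval y ^ 2 :=
    intervalIntegral.integral_nonneg hx.1 fun x _ => sq_nonneg _
  calc P.eval x ^ 2 ≤ P.eval x ^ 2 * (x - -1) :=
        le_mul_of_one_le_right (sq_nonneg _) (by linarith)
    _ ≤ 2 * (2 * n + 1) ^ 2 * ∫ y in (-1 : ℝ)..x, P.eval y ^ 2 :=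
        eval_sq_mul_le_integral hdeg (by linarith)
    _ ≤ 18 * n ^ 2 * ∫ y in (-1 : ℝ)..1, P.eval y ^ 2 := by
        gcongr ?_ * ?_
        nlinarith

/-- At least half of the `L²`-mass of a polynomial of degree at most `n` on `[-1, 1]` lies at
distance at least `1 / (72 n²)` from the endpoints. -/
theorem integral_sq_le_two_mul_integral_sq {n : ℕ} (hn : 1 ≤ n) {P : ℝ[X]}
    (hdeg : P.natDegree ≤ n) {δ : ℝ} (hδ : δ = 1 / (72 * n ^ 2)) :
    ∫ x in (-1 : ℝ)..1, P.eval x ^ 2 ≤ 2 * ∫ x in (-1 + δ)..(1 - δ), P.eval x ^ 2 := by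
  have hn' : (1 : ℝ) ≤ n := by exact_mod_cast hn
  have hδ0 : 0 < δ := by rw [hδ]; positivity
  have hδn : 72 * n ^ 2 * δ = 1 := by rw [hδ]; field_simp
  have hδ1 : δ ≤ 1 := by nlinarith
  have hint (a b : ℝ) : IntervalIntegrable (fun x => P.eval x ^ 2) volume a b :=
    (by fun_prop : Continuous fun x => P.eval x ^ 2).intervalIntegrable _ _
  set I := ∫ x in (-1 : ℝ)..1, P.eval x ^ 2 with hI
  have hbound {a b : ℝ} (hab : a ≤ b) (ha : -1 ≤ a) (hb : b ≤ 1) :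
      ∫ x in a..b, P.eval x ^ 2 ≤ 18 * n ^ 2 * I * (b - a) := by
    calc ∫ x in a..b, P.eval x ^ 2 ≤ ∫ x in a..b, 18 * n ^ 2 * I :=
          intervalIntegral.integral_mono_on hab (hint _ _) intervalIntegrable_const fun x hx =>
            eval_sq_le_integral hn hdeg ⟨ha.trans hx.1, hx.2.trans hb⟩
      _ = 18 * n ^ 2 * I * (b - a) := by
          rw [intervalIntegral.integral_const, smul_eq_mul, mul_comm]
  have h1 := hbound (a := -1) (b := -1 + δ) (by linarith) le_rfl (by linarith)
  have h2 := hbound (a := 1 - δ) (b := 1) (by linarith) (by linarith) le_rfl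
  have hsplit : (∫ x in (-1 : ℝ)..(-1 + δ), P.eval x ^ 2) +
      (∫ x in (-1 + δ)..(1 - δ), P.eval x ^ 2) + (∫ x in (1 - δ)..1, P.eval x ^ 2) = I := by
    rw [intervalIntegral.integral_add_adjacent_intervals (hint _ _) (hint _ _),
      intervalIntegral.integral_add_adjacent_intervals (hint _ _) (hint _ _)]
  have h3 : 18 * n ^ 2 * I * δ = I / 4 := by linear_combination I / 4 * hδn
  ring_nf at h1 h2 h3 hsplit ⊢
  linarith

theorem intervalIntegrable_jacobiWeight {α β : ℝ} (hα : -1 < α) (hβ : -1 < β) :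
    IntervalIntegrable (fun x : ℝ => (1 - x) ^ α * (1 + x) ^ β) volume (-1) 1 := by
  have hleft (γ a b : ℝ) (hγ : -1 < γ) :
      IntervalIntegrable (fun x : ℝ => (1 - x) ^ γ) volume a b := by
    simpa using (intervalIntegral.intervalIntegrable_rpow' (a := 1 - a) (b := 1 - b)
      hγ).comp_sub_left 1
  have hright (γ a b : ℝ) (hγ : -1 < γ) :
      IntervalIntegrable (fun x : ℝ => (1 + x) ^ γ) volume a b := by
    simpa using (intervalIntegral.intervalIntegrable_rpow' (a := 1 + a) (b := 1 + b)
      hγ).comp_add_left 1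
  refine IntervalIntegrable.trans (b := 0) ?_ ?_
  · refine (hright β _ _ hβ).continuousOn_mul ?_
    refine ContinuousOn.rpow_const (by fun_prop) fun x hx => Or.inl ?_
    rw [Set.uIcc_of_le (by norm_num)] at hx
    linarith [hx.2]
  · refine (hleft α _ _ hα).mul_continuousOn ?_
    refine ContinuousOn.rpow_const (by fun_prop) fun x hx => Or.inl ?_
    rw [Set.uIcc_of_le (by norm_num)] at hx
    linarith [hx.1]

theorem rpow_div_two_le_jacobiWeight {α β μ δ x : ℝ} (hα : -1 < α) (hβ : -1 < β) (hμ : 0 ≤ μ)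
    (hαμ : α ≤ μ) (hβμ : β ≤ μ) (hδ : 0 < δ) (hx : x ∈ Set.Icc (-1 + δ) (1 - δ)) :
    δ ^ μ / 2 ≤ (1 - x) ^ α * (1 + x) ^ β := by
  wlog h0 : 0 ≤ x generalizing α β x
  · have h := this (x := -x) hβ hα hβμ hαμ ⟨by linarith [hx.2], by linarith [hx.1]⟩ (by linarith)
    rwa [mul_comm, sub_neg_eq_add, ← sub_eq_add_neg] at h
  obtain ⟨-, hx2⟩ := hx
  have hfar : (1 : ℝ) / 2 ≤ (1 + x) ^ β := by
    calc (1 : ℝ) / 2 ≤ (1 + x)⁻¹ := by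
          rw [one_div]
          exact inv_anti₀ (by linarith) (by linarith)
      _ = (1 + x) ^ (-1 : ℝ) := (Real.rpow_neg_one _).symm
      _ ≤ (1 + x) ^ β := Real.rpow_le_rpow_of_exponent_le (by linarith) hβ.le
  have hnear : δ ^ μ ≤ (1 - x) ^ α :=
    (Real.rpow_le_rpow hδ.le (by linarith) hμ).trans
      (Real.rpow_le_rpow_of_exponent_ge (by linarith) (by linarith) hαμ)
  calc δ ^ μ / 2 = δ ^ μ * (1 / 2) := by ring
    _ ≤ (1 - x) ^ α * (1 + x) ^ β :=
        mul_le_mul hnear hfar (by norm_num) ((Real.rpow_nonneg hδ.le _).trans hnear)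

/-- Comparison between the unweighted and the Jacobi-weighted L²-norms of polynomials on
`[-1,1]`: if `max(α,β) ≥ -1/2` and `α, β > -1`, then
`∫_{-1}^1 |P|² ≤ k₁ n^{v(α,β)} ∫_{-1}^1 |P(x)|² (1-x)^α (1+x)^β dx`
with `v(α,β) = α + β + |α-β| + 2`. -/
theorem unweighted_le_jacobi_weighted (α β : ℝ) (hα : -1 < α) (hβ : -1 < β)
    (hq : -(1 / 2) ≤ max α β) :
    ∃ k₁ : ℝ, 0 < k₁ ∧ ∀ (n : ℕ), 1 ≤ n → ∀ P : Polynomial ℝ, P.natDegree ≤ n →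
      ∫ x in Set.Icc (-1 : ℝ) 1, (P.eval x) ^ 2 ≤
        k₁ * (n : ℝ) ^ (α + β + |α - β| + 2) *
          ∫ x in Set.Icc (-1 : ℝ) 1, (P.eval x) ^ 2 * ((1 - x) ^ α * (1 + x) ^ β) := by
  set μ := max (max α β) 0
  have hμ : 0 ≤ μ := le_max_right _ _
  have hv : 2 * μ ≤ α + β + |α - β| + 2 := by
    have hmax : α + β + |α - β| = 2 * max α β := by
      linarith [max_add_min α β, max_sub_min_eq_abs α β, abs_sub_comm α β]
    rw [hmax]
    rcases max_cases (max α β) 0 with h | h <;> linarith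
  refine ⟨4 * 72 ^ μ, by positivity, fun n hn P hdeg => ?_⟩
  rw [integral_Icc_eq_integral_Ioc, integral_Icc_eq_integral_Ioc,
    ← intervalIntegral.integral_of_le (by norm_num),
    ← intervalIntegral.integral_of_le (by norm_num)]
  have hn' : (1 : ℝ) ≤ n := by exact_mod_cast hn
  obtain ⟨δ, hδ⟩ : ∃ δ : ℝ, δ = 1 / (72 * n ^ 2) := ⟨_, rfl⟩
  have hδ0 : 0 < δ := by rw [hδ]; positivity
  have hδn : 72 * n ^ 2 * δ = 1 := by rw [hδ]; field_simp
  have hδ1 : δ ≤ 1 := by nlinarith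
  have hδμ : (72 ^ μ * (n : ℝ) ^ (2 * μ)) * δ ^ μ = 1 := by
    rw [Real.rpow_mul (by positivity), Real.rpow_two, ← Real.mul_rpow (by positivity)
      (by positivity), ← Real.mul_rpow (by positivity) hδ0.le, hδn, Real.one_rpow]
  have hcont : Continuous fun x => P.eval x ^ 2 := by fun_prop
  have hint : IntervalIntegrable
      (fun x => P.eval x ^ 2 * ((1 - x) ^ α * (1 + x) ^ β)) volume (-1) 1 :=
    (intervalIntegrable_jacobiWeight hα hβ).continuousOn_mul hcont.continuousOn
  have hnonneg : ∀ x ∈ Set.Ioc (-1 : ℝ) 1,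
      0 ≤ P.eval x ^ 2 * ((1 - x) ^ α * (1 + x) ^ β) := fun x hx =>
    mul_nonneg (sq_nonneg _) (mul_nonneg (Real.rpow_nonneg (by linarith [hx.2]) _)
      (Real.rpow_nonneg (by linarith [hx.1]) _))
  set J := ∫ x in (-1 : ℝ)..1, P.eval x ^ 2 * ((1 - x) ^ α * (1 + x) ^ β) with hJ
  have hJ0 : 0 ≤ J := by
    rw [hJ, intervalIntegral.integral_of_le (by norm_num)]
    exact setIntegral_nonneg measurableSet_Ioc hnonneg
  have hmid : δ ^ μ / 2 * ∫ x in (-1 + δ)..(1 - δ), P.eval x ^ 2 ≤ J := by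
    rw [← intervalIntegral.integral_const_mul]
    refine (intervalIntegral.integral_mono_on (by linarith)
      ((hcont.intervalIntegrable _ _).const_mul _) (hint.mono_set ?_) fun x hx => ?_).trans
      (intervalIntegral.integral_mono_interval (by linarith) (by linarith) (by linarith)
        ((ae_restrict_iff' measurableSet_Ioc).mpr (Filter.Eventually.of_forall hnonneg)) hint)
    · rw [Set.uIcc_of_le (by linarith), Set.uIcc_of_le (by linarith)]
      exact Set.Icc_subset_Icc (by linarith) (by linarith)
    · rw [mul_comm]
      exact mul_le_mul_of_nonneg_left (rpow_div_two_le_jacobiWeight hα hβ hμ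
        ((le_max_left _ _).trans (le_max_left _ _)) ((le_max_right _ _).trans (le_max_left _ _))
        hδ0 hx) (sq_nonneg _)
  set K := ∫ x in (-1 + δ)..(1 - δ), P.eval x ^ 2
  calc ∫ x in (-1 : ℝ)..1, P.eval x ^ 2 ≤ 2 * K :=
        integral_sq_le_two_mul_integral_sq hn hdeg hδ
    _ = 4 * (72 ^ μ * (n : ℝ) ^ (2 * μ)) * (δ ^ μ / 2 * K) := by
        linear_combination (-2 * K) * hδμ
    _ ≤ 4 * (72 ^ μ * (n : ℝ) ^ (2 * μ)) * J := by gcongr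
    _ = 4 * 72 ^ μ * (n : ℝ) ^ (2 * μ) * J := by ring
    _ ≤ 4 * 72 ^ μ * (n : ℝ) ^ (α + β + |α - β| + 2) * J := by gcongr
end
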